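/- arXiv:2206.11369 — 2 statements merged into one kernel-verified Lean document; each statement's English description precedes it below -/
import Mathlib

section
/- Let β > 0 and assume that every conditional distribution minimizing L_β is a fixed point of BA_β in encoder coordinates (BA_β[q] = q). If q minimizes L_β and the derivative at q of the map q ↦ q − BA_β[q] on ℝ^{𝒳̂×𝒳} has trivial kernel (is injective), then q is the unique minimizer of L_β among all conditional distributions. -/
open scoped BigOperators

variable {X Xhat : Type*} [Fintype X] [Fintype Xhat]

/-- `q` is a conditional distribution: each `q(·|x)` is a probability distribution on `𝒳̂`. -/
def IsCond (q : Xhat → X → ℝ) : Prop :=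
  ∀ x : X, (∀ xh : Xhat, 0 ≤ q xh x) ∧ ∑ xh : Xhat, q xh x = 1

/-- The marginal `s(x̂) = ∑_x p_X(x)·q(x̂|x)`. -/
noncomputable def margQ (p : X → ℝ) (q : Xhat → X → ℝ) (xh : Xhat) : ℝ :=
  ∑ x : X, p x * q xh x

/-- The Blahut–Arimoto iteration in encoder coordinates:
`BA_β[q](x̂|x) = s(x̂)·e^{−β d(x,x̂)} / ∑_{x̂''} s(x̂'')·e^{−β d(x,x̂'')}`. -/
noncomputable def BAenc (p : X → ℝ) (d : X → Xhat → ℝ) (β : ℝ) (q : Xhat → X → ℝ) :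
    Xhat → X → ℝ :=
  fun xh x =>
    margQ p q xh * Real.exp (-β * d x xh) /
      ∑ xh'' : Xhat, margQ p q xh'' * Real.exp (-β * d x xh'')

/-- The mutual information
`I(q) = ∑_{x,x̂ : p(x)q(x̂|x) > 0} p(x)·q(x̂|x)·log(q(x̂|x)/q(x̂))`. -/
noncomputable def mutualInfo (p : X → ℝ) (q : Xhat → X → ℝ) : ℝ :=
  ∑ x : X, ∑ xh : Xhat,
    if 0 < p x * q xh x then p x * q xh x * Real.log (q xh x / margQ p q xh) else 0

/-- The expected distortion `D(q) = ∑_{x,x̂} p(x)·q(x̂|x)·d(x,x̂)`. -/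
noncomputable def expDist (p : X → ℝ) (d : X → Xhat → ℝ) (q : Xhat → X → ℝ) : ℝ :=
  ∑ x : X, ∑ xh : Xhat, p x * q xh x * d x xh

/-- The rate-distortion Lagrangian `L_β(q) = I(q) + β·D(q)`. -/
noncomputable def Lagr (p : X → ℝ) (d : X → Xhat → ℝ) (β : ℝ) (q : Xhat → X → ℝ) : ℝ :=
  mutualInfo p q + β * expDist p d q

/-- `q` attains the minimum of `L_β` over all conditional distributions. -/
def IsMinimizer (p : X → ℝ) (d : X → Xhat → ℝ) (β : ℝ) (q : Xhat → X → ℝ) : Prop :=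
  IsCond q ∧ ∀ q' : Xhat → X → ℝ, IsCond q' → Lagr p d β q ≤ Lagr p d β q'

/-- Tangent-line bound for the perspective of `a ↦ a log a`. -/
theorem mul_log_add_sub_le_mul_log_div {a b c : ℝ} (ha : 0 ≤ a) (hb : 0 ≤ b)
    (hab : b = 0 → a = 0) (hc : 0 < c) :
    a * Real.log c + a - c * b ≤ a * Real.log (a / b) := by
  rcases ha.eq_or_lt with rfl | ha
  · simpa using mul_nonneg hc.le hb
  have hb : 0 < b := hb.lt_of_ne' fun h => ha.ne' (hab h)
  have h := Real.log_le_sub_one_of_pos (show 0 < c * b / a by positivity)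
  rw [Real.log_div (by positivity) ha.ne', Real.log_mul hc.ne' hb.ne'] at h
  rw [Real.log_div ha.ne' hb.ne']
  have h' := mul_le_mul_of_nonneg_left h ha.le
  have e : a * (c * b / a - 1) = c * b - a := by field_simp
  rw [e] at h'
  linarith

/-- The log-sum inequality for two convexly weighted terms. -/
theorem mul_log_div_convex {a b a' b' s t : ℝ} (ha : 0 ≤ a) (hb : 0 ≤ b) (hab : b = 0 → a = 0)
    (ha' : 0 ≤ a') (hb' : 0 ≤ b') (hab' : b' = 0 → a' = 0) (hs : 0 ≤ s) (ht : 0 ≤ t) :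
    (s * a + t * a') * Real.log ((s * a + t * a') / (s * b + t * b')) ≤
      s * (a * Real.log (a / b)) + t * (a' * Real.log (a' / b')) := by
  have hB : 0 ≤ s * b + t * b' := by positivity
  have hA : 0 ≤ s * a + t * a' := by positivity
  have hBA : s * b + t * b' = 0 → s * a + t * a' = 0 := by
    intro h
    have h1 : s * b = 0 := by linarith [mul_nonneg hs hb, mul_nonneg ht hb']
    have h2 : t * b' = 0 := by linarith
    have h3 : s * a = 0 := by
      rcases mul_eq_zero.1 h1 with h | h
      · simp [h]
      · simp [hab h]
    have h4 : t * a' = 0 := by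
      rcases mul_eq_zero.1 h2 with h | h
      · simp [h]
      · simp [hab' h]
    rw [h3, h4, add_zero]
  rcases hA.eq_or_lt with hA0 | hA
  · have h1 : s * a = 0 := by linarith [mul_nonneg hs ha, mul_nonneg ht ha']
    have h2 : t * a' = 0 := by linarith
    rw [← hA0, ← mul_assoc, ← mul_assoc, h1, h2]
    simp
  have hB : 0 < s * b + t * b' := hB.lt_of_ne' fun h => hA.ne' (hBA h)
  have hc := div_pos hA hB
  have e : (s * a + t * a') / (s * b + t * b') * (s * b + t * b') = s * a + t * a' :=
    div_mul_cancel₀ _ hB.ne'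
  have h1 := mul_le_mul_of_nonneg_left (mul_log_add_sub_le_mul_log_div ha hb hab hc) hs
  have h2 := mul_le_mul_of_nonneg_left (mul_log_add_sub_le_mul_log_div ha' hb' hab' hc) ht
  linarith

theorem convex_isCond {X Xhat : Type*} [Fintype Xhat] : Convex ℝ {q : Xhat → X → ℝ | IsCond q} := by
  intro q hq q' hq' s t hs ht hst x
  obtain ⟨h0, h1⟩ := hq x
  obtain ⟨h0', h1'⟩ := hq' x
  refine ⟨fun xh => add_nonneg (mul_nonneg hs (h0 xh)) (mul_nonneg ht (h0' xh)), ?_⟩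
  simp [Finset.sum_add_distrib, ← Finset.mul_sum, h1, h1', hst]

theorem margQ_nonneg {p : X → ℝ} (hp0 : ∀ x, 0 ≤ p x) {q : Xhat → X → ℝ} (hq : IsCond q)
    (xh : Xhat) : 0 ≤ margQ p q xh :=
  Finset.sum_nonneg fun x _ => mul_nonneg (hp0 x) ((hq x).1 xh)

theorem eq_zero_of_margQ_eq_zero {p : X → ℝ} (hp0 : ∀ x, 0 ≤ p x) {q : Xhat → X → ℝ}
    (hq : IsCond q) {x : X} (hx : 0 < p x) {xh : Xhat} (h : margQ p q xh = 0) : q xh x = 0 := by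
  have h' := (Finset.sum_eq_zero_iff_of_nonneg
    fun x _ => mul_nonneg (hp0 x) ((hq x).1 xh)).1 h x (Finset.mem_univ x)
  exact (mul_eq_zero.1 h').resolve_left hx.ne'

theorem sum_margQ {p : X → ℝ} {q : Xhat → X → ℝ} (hq : IsCond q) :
    ∑ xh, margQ p q xh = ∑ x, p x := by
  simp only [margQ]
  rw [Finset.sum_comm]
  simp [← Finset.mul_sum, (hq _).2]

theorem margQ_add_smul {X Xhat : Type*} [Fintype X] (p : X → ℝ) (q q' : Xhat → X → ℝ)
    (s t : ℝ) (xh : Xhat) :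
    margQ p (s • q + t • q') xh = s * margQ p q xh + t * margQ p q' xh := by
  simp only [margQ, Finset.mul_sum, ← Finset.sum_add_distrib]
  exact Finset.sum_congr rfl fun x _ => by simp; ring

theorem expDist_add_smul (p : X → ℝ) (d : X → Xhat → ℝ) (q q' : Xhat → X → ℝ) (s t : ℝ) :
    expDist p d (s • q + t • q') = s * expDist p d q + t * expDist p d q' := by
  simp only [expDist, Finset.mul_sum, ← Finset.sum_add_distrib]
  exact Finset.sum_congr rfl fun x _ => Finset.sum_congr rfl fun xh _ => by simp; ring

theorem mutualInfo_eq {p : X → ℝ} (hp0 : ∀ x, 0 ≤ p x) {q : Xhat → X → ℝ} (hq : IsCond q) :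
    mutualInfo p q = ∑ x, ∑ xh, p x * (q xh x * Real.log (q xh x / margQ p q xh)) := by
  refine Finset.sum_congr rfl fun x _ => Finset.sum_congr rfl fun xh _ => ?_
  split_ifs with h
  · ring
  · have h0 : p x * q xh x = 0 := le_antisymm (not_lt.1 h) (mul_nonneg (hp0 x) ((hq x).1 xh))
    rw [← mul_assoc, h0, zero_mul]

theorem convexOn_mutualInfo {p : X → ℝ} (hp0 : ∀ x, 0 ≤ p x) :
    ConvexOn ℝ {q : Xhat → X → ℝ | IsCond q} (mutualInfo p) := by
  refine ⟨convex_isCond, fun q hq q' hq' s t hs ht hst => ?_⟩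
  rw [mutualInfo_eq hp0 (convex_isCond hq hq' hs ht hst), mutualInfo_eq hp0 hq,
    mutualInfo_eq hp0 hq']
  simp only [smul_eq_mul, Finset.mul_sum, ← Finset.sum_add_distrib]
  refine Finset.sum_le_sum fun x _ => Finset.sum_le_sum fun xh _ => ?_
  rw [margQ_add_smul]
  rcases (hp0 x).eq_or_lt with hx | hx
  · simp [← hx]
  have h := mul_le_mul_of_nonneg_left
    (mul_log_div_convex ((hq x).1 xh) (margQ_nonneg hp0 hq xh)
      (eq_zero_of_margQ_eq_zero hp0 hq hx) ((hq' x).1 xh) (margQ_nonneg hp0 hq' xh)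
      (eq_zero_of_margQ_eq_zero hp0 hq' hx) hs ht) hx.le
  simp only [Pi.add_apply, Pi.smul_apply, smul_eq_mul]
  linarith

theorem convexOn_Lagr {p : X → ℝ} (hp0 : ∀ x, 0 ≤ p x) (d : X → Xhat → ℝ) (β : ℝ) :
    ConvexOn ℝ {q : Xhat → X → ℝ | IsCond q} (Lagr p d β) := by
  refine ⟨convex_isCond, fun q hq q' hq' s t hs ht hst => ?_⟩
  have h := (convexOn_mutualInfo hp0).2 hq hq' hs ht hst
  simp only [Lagr, expDist_add_smul, smul_eq_mul] at h ⊢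
  linarith

theorem convex_isMinimizer {p : X → ℝ} (hp0 : ∀ x, 0 ≤ p x) (d : X → Xhat → ℝ) (β : ℝ) :
    Convex ℝ {q : Xhat → X → ℝ | IsMinimizer p d β q} := by
  intro q hq q' hq' s t hs ht hst
  refine ⟨convex_isCond hq.1 hq'.1 hs ht hst, fun r hr => ?_⟩
  have h := (convexOn_Lagr hp0 d β).2 hq.1 hq'.1 hs ht hst
  calc Lagr p d β (s • q + t • q') ≤ s * Lagr p d β q + t * Lagr p d β q' := h
    _ ≤ s * Lagr p d β r + t * Lagr p d β r :=
      add_le_add (mul_le_mul_of_nonneg_left (hq.2 r hr) hs)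
        (mul_le_mul_of_nonneg_left (hq'.2 r hr) ht)
    _ = Lagr p d β r := by rw [← add_mul, hst, one_mul]

theorem sum_margQ_mul_exp_pos {p : X → ℝ} (hp0 : ∀ x, 0 ≤ p x) (hp1 : ∑ x, p x = 1)
    (d : X → Xhat → ℝ) (β : ℝ) {q : Xhat → X → ℝ} (hq : IsCond q) (x : X) :
    0 < ∑ xh, margQ p q xh * Real.exp (-β * d x xh) := by
  have h : 0 < ∑ xh, margQ p q xh := by simp [sum_margQ hq, hp1]
  obtain ⟨xh, -, hxh⟩ := Finset.exists_ne_zero_of_sum_ne_zero h.ne'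
  exact Finset.sum_pos' (fun xh _ => mul_nonneg (margQ_nonneg hp0 hq xh) (Real.exp_pos _).le)
    ⟨xh, Finset.mem_univ xh,
      mul_pos ((margQ_nonneg hp0 hq xh).lt_of_ne' hxh) (Real.exp_pos _)⟩

theorem differentiableAt_BAenc {p : X → ℝ} (hp0 : ∀ x, 0 ≤ p x) (hp1 : ∑ x, p x = 1)
    (d : X → Xhat → ℝ) (β : ℝ) {q : Xhat → X → ℝ} (hq : IsCond q) :
    DifferentiableAt ℝ (BAenc p d β) q := by
  have hm (xh : Xhat) : DifferentiableAt ℝ (fun r : Xhat → X → ℝ => margQ p r xh) q := by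
    unfold margQ
    fun_prop
  refine differentiableAt_pi.2 fun xh => differentiableAt_pi.2 fun x => ?_
  have hnum := (hm xh).mul_const (Real.exp (-β * d x xh))
  have hden : DifferentiableAt ℝ
      (fun r : Xhat → X → ℝ => ∑ xh', margQ p r xh' * Real.exp (-β * d x xh')) q :=
    DifferentiableAt.fun_sum fun xh' _ => (hm xh').mul_const _
  simpa only [BAenc, div_eq_mul_inv] using
    hnum.fun_mul (hden.fun_inv (sum_margQ_mul_exp_pos hp0 hp1 d β hq x).ne')

/-- If `F` vanishes on the segment from `x` to `y`, its derivative at `x` kills `y - x`. -/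
theorem fderiv_sub_eq_zero_of_segment {E G : Type*} [NormedAddCommGroup E] [NormedSpace ℝ E]
    [NormedAddCommGroup G] [NormedSpace ℝ G] {F : E → G} {x y : E}
    (hF : DifferentiableAt ℝ F x) (h : ∀ z ∈ segment ℝ x y, F z = 0) :
    fderiv ℝ F x (y - x) = 0 := by
  have hl : HasDerivAt (AffineMap.lineMap x y : ℝ → E) (y - x) 0 := AffineMap.hasDerivAt_lineMap
  have hF' : HasFDerivAt F (fderiv ℝ F x) (AffineMap.lineMap x y (0 : ℝ)) := by
    simpa using hF.hasFDerivAt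
  have h1 := (hF'.comp_hasDerivAt 0 hl).hasDerivWithinAt (s := Set.Icc 0 1)
  have hz : Set.EqOn (F ∘ (AffineMap.lineMap x y : ℝ → E)) (fun _ => 0) (Set.Icc 0 1) :=
    fun t ht => h _ (segment_eq_image_lineMap ℝ x y ▸ Set.mem_image_of_mem _ ht)
  have h0 : (0 : ℝ) ∈ Set.Icc (0 : ℝ) 1 := by simp
  exact (uniqueDiffOn_Icc one_pos 0 h0).eq_deriv _ h1
    ((hasDerivWithinAt_const 0 _ (0 : G)).congr hz (hz h0))

/-- **A trivial kernel of the encoder Jacobian implies uniqueness of the minimizer**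
(Corollary `cor:RT-assumptions-hold-for-RD`): if the minimizers of `L_β` are fixed points
of `BA_β`, `q` minimizes `L_β`, and the derivative at `q` of `q ↦ q − BA_β[q]` has trivial
kernel, then `q` is the unique minimizer of `L_β`. -/
theorem trivialKernelUniqueMinimizer (p : X → ℝ) (hp0 : ∀ x, 0 ≤ p x) (hp1 : ∑ x, p x = 1)
    (d : X → Xhat → ℝ) (β : ℝ) (hβ : 0 < β)
    (hfix : ∀ q : Xhat → X → ℝ, IsMinimizer p d β q → BAenc p d β q = q)
    (q : Xhat → X → ℝ) (hq : IsMinimizer p d β q)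
    (hker : ∀ v : Xhat → X → ℝ,
      fderiv ℝ (fun q' : Xhat → X → ℝ => q' - BAenc p d β q') q v = 0 → v = 0) :
    ∀ q' : Xhat → X → ℝ, IsMinimizer p d β q' → q' = q := by
  intro q' hq'
  refine sub_eq_zero.1 (hker _ (fderiv_sub_eq_zero_of_segment
    (differentiableAt_id.fun_sub (differentiableAt_BAenc hp0 hp1 d β hq.1)) fun r hr => ?_))
  rw [hfix r ((convex_isMinimizer hp0 d β).segment_subset hq hq' hr), sub_self]
end

section
/- Let β > 0 and let r₀ be a probability distribution on 𝒳̂ with support S := {x̂ : r₀(x̂) > 0}. Then the sequence of Blahut–Arimoto iterates BA_β^n[r₀] converges as n → ∞ to a probability distribution r* on 𝒳̂ supported in S, and there exists a conditional distribution q* with q*(x̂|x) = 0 for all x̂ ∉ S and all x, whose marginal satisfies r*(x̂) = ∑_x p_X(x)·q*(x̂|x), and which minimizes the Lagrangian L_β(q) = I(q) + β·D(q) over all conditional distributions q satisfying q(x̂|x) = 0 for every x̂ ∉ S. -/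
open scoped BigOperators

variable {X Xhat : Type*} [Fintype X] [Fintype Xhat]

/-- The partition function `Z(x, β) = ∑_{x̂'} r(x̂')·e^{−β d(x,x̂')}`. -/
noncomputable def Zf (d : X → Xhat → ℝ) (r : Xhat → ℝ) (β : ℝ) (x : X) : ℝ :=
  ∑ xh' : Xhat, r xh' * Real.exp (-β * d x xh')

/-- The encoder `q[r](x̂|x) = r(x̂)·e^{−β d(x,x̂)} / Z(x,β)`. -/
noncomputable def enc (d : X → Xhat → ℝ) (r : Xhat → ℝ) (β : ℝ) (xh : Xhat) (x : X) : ℝ :=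
  r xh * Real.exp (-β * d x xh) / Zf d r β x

/-- The Blahut–Arimoto iteration `BA_β[r] : x̂ ↦ ∑_x p_X(x)·q[r](x̂|x)`, as a map on
`ℝ^{𝒳̂}`. -/
noncomputable def BA (p : X → ℝ) (d : X → Xhat → ℝ) (β : ℝ) (r : Xhat → ℝ) : Xhat → ℝ :=
  fun xh => ∑ x : X, p x * enc d r β xh x

theorem sum_mul_log_le_log {ι : Type*} [Fintype ι] {w t : ι → ℝ} {T : ℝ}
    (hw : ∀ i, 0 ≤ w i) (hw1 : ∑ i, w i = 1) (ht : ∀ i, 0 < w i → 0 < t i)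
    (hT : ∑ i, w i * t i ≤ T) : ∑ i, w i * Real.log (t i) ≤ Real.log T := by
  have hpos : 0 < ∑ i, w i * t i := by
    obtain ⟨i, -, hi⟩ : ∃ i ∈ Finset.univ, 0 < w i :=
      Finset.exists_lt_of_sum_lt (f := fun _ => (0 : ℝ)) (by simp [hw1])
    refine Finset.sum_pos' (fun j _ => ?_) ⟨i, Finset.mem_univ i, mul_pos hi (ht i hi)⟩
    rcases (hw j).eq_or_lt with h | h
    · simp [← h]
    · exact (mul_pos h (ht j h)).le
  have hT0 : 0 < T := hpos.trans_le hT
  calc ∑ i, w i * Real.log (t i)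
      ≤ ∑ i, (w i * (Real.log T - 1) + w i * t i / T) := by
        refine Finset.sum_le_sum fun i _ => ?_
        rcases (hw i).eq_or_lt with h | h
        · simp [← h]
        · have := Real.log_le_sub_one_of_pos (div_pos (ht i h) hT0)
          rw [Real.log_div (ht i h).ne' hT0.ne'] at this
          have := mul_le_mul_of_nonneg_left this h.le
          linarith [mul_div_assoc (w i) (t i) T]
    _ = Real.log T - 1 + (∑ i, w i * t i) / T := by
        rw [Finset.sum_add_distrib, ← Finset.sum_mul, hw1, Finset.sum_div, one_mul]
    _ ≤ Real.log T := by linarith [(div_le_one hT0).2 hT]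

/-- The squared Hellinger distance is bounded by the relative entropy. -/
theorem sum_sq_sqrt_sub_sqrt_le {ι : Type*} [Fintype ι] {a b : ι → ℝ}
    (ha : a ∈ stdSimplex ℝ ι) (hb : b ∈ stdSimplex ℝ ι) (hab : ∀ i, 0 < a i → 0 < b i) :
    ∑ i, (√(a i) - √(b i)) ^ 2 ≤ ∑ i, a i * Real.log (a i) - ∑ i, a i * Real.log (b i) := by
  have key : ∀ i, (√(a i) - √(b i)) ^ 2 ≤
      a i * Real.log (a i) - a i * Real.log (b i) + (b i - a i) := by
    intro i
    have hb2 := Real.sq_sqrt (hb.1 i)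
    rcases (ha.1 i).eq_or_lt with h | h
    · simp [← h, hb2]
    · have ha2 := Real.sq_sqrt h.le
      have hsa := Real.sqrt_pos.2 h
      have hsb := Real.sqrt_pos.2 (hab i h)
      have h1 := Real.log_le_sub_one_of_pos (div_pos hsb hsa)
      rw [Real.log_div hsb.ne' hsa.ne', Real.log_sqrt h.le, Real.log_sqrt (hb.1 i)] at h1
      have h2 := mul_le_mul_of_nonneg_left h1 h.le
      have h3 : a i * (√(b i) / √(a i) - 1) = √(a i) * √(b i) - a i := by
        nth_rw 1 [← ha2]
        field_simp
        linear_combination -ha2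
      nlinarith
  calc _ ≤ ∑ i, (a i * Real.log (a i) - a i * Real.log (b i) + (b i - a i)) :=
        Finset.sum_le_sum fun i _ => key i
    _ = _ := by
        rw [Finset.sum_add_distrib, Finset.sum_sub_distrib, Finset.sum_sub_distrib, ha.2, hb.2]
        ring

theorem Zf_pos (d : X → Xhat → ℝ) {r : Xhat → ℝ} (hr : r ∈ stdSimplex ℝ Xhat) (β : ℝ) (x : X) :
    0 < Zf d r β x := by
  obtain ⟨i, -, hi⟩ : ∃ i ∈ Finset.univ, 0 < r i :=
    Finset.exists_lt_of_sum_lt (f := fun _ => (0 : ℝ)) (by simp [hr.2])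
  exact Finset.sum_pos' (fun j _ => mul_nonneg (hr.1 j) (Real.exp_pos _).le)
    ⟨i, Finset.mem_univ i, mul_pos hi (Real.exp_pos _)⟩

theorem isCond_enc (d : X → Xhat → ℝ) {r : Xhat → ℝ} (hr : r ∈ stdSimplex ℝ Xhat) (β : ℝ) :
    IsCond (enc d r β) := fun x =>
  ⟨fun xh => div_nonneg (mul_nonneg (hr.1 xh) (Real.exp_pos _).le) (Zf_pos d hr β x).le, by
    simp only [enc]
    rw [← Finset.sum_div]
    exact div_self (Zf_pos d hr β x).ne'⟩

theorem margQ_mem_stdSimplex {p : X → ℝ} (hp : p ∈ stdSimplex ℝ X) {q : Xhat → X → ℝ}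
    (hq : IsCond q) : margQ p q ∈ stdSimplex ℝ Xhat := by
  refine ⟨fun xh => Finset.sum_nonneg fun x _ => mul_nonneg (hp.1 x) ((hq x).1 xh), ?_⟩
  simp only [margQ]
  rw [Finset.sum_comm]
  simp [← Finset.mul_sum, (hq _).2, hp.2]

theorem BA_mem_stdSimplex {p : X → ℝ} (hp : p ∈ stdSimplex ℝ X) (d : X → Xhat → ℝ) (β : ℝ)
    {r : Xhat → ℝ} (hr : r ∈ stdSimplex ℝ Xhat) : BA p d β r ∈ stdSimplex ℝ Xhat :=
  margQ_mem_stdSimplex hp (isCond_enc d hr β)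

/-- The factor by which a Blahut–Arimoto step multiplies the mass of a reproduction symbol. -/
noncomputable def baFactor (p : X → ℝ) (d : X → Xhat → ℝ) (β : ℝ) (r : Xhat → ℝ) (xh : Xhat) : ℝ :=
  ∑ x, p x * (Real.exp (-β * d x xh) / Zf d r β x)

theorem BA_eq_mul_baFactor (p : X → ℝ) (d : X → Xhat → ℝ) (β : ℝ) (r : Xhat → ℝ) (xh : Xhat) :
    BA p d β r xh = r xh * baFactor p d β r xh := by
  simp only [BA, baFactor, enc, Finset.mul_sum]
  exact Finset.sum_congr rfl fun x _ => by ring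

theorem baFactor_pos {p : X → ℝ} (hp : p ∈ stdSimplex ℝ X) (d : X → Xhat → ℝ) (β : ℝ)
    {r : Xhat → ℝ} (hr : r ∈ stdSimplex ℝ Xhat) (xh : Xhat) : 0 < baFactor p d β r xh := by
  obtain ⟨i, -, hi⟩ : ∃ i ∈ Finset.univ, 0 < p i :=
    Finset.exists_lt_of_sum_lt (f := fun _ => (0 : ℝ)) (by simp [hp.2])
  exact Finset.sum_pos'
    (fun j _ => mul_nonneg (hp.1 j) (div_pos (Real.exp_pos _) (Zf_pos d hr β j)).le)
    ⟨i, Finset.mem_univ i, mul_pos hi (div_pos (Real.exp_pos _) (Zf_pos d hr β i))⟩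

/-- The averaged log-partition function, the negative of the minimum of the Lagrangian relative
to the output distribution `r`. -/
noncomputable def avgLogZ (p : X → ℝ) (d : X → Xhat → ℝ) (β : ℝ) (r : Xhat → ℝ) : ℝ :=
  ∑ x, p x * Real.log (Zf d r β x)

theorem continuousOn_avgLogZ (p : X → ℝ) (d : X → Xhat → ℝ) (β : ℝ) :
    ContinuousOn (avgLogZ p d β) (stdSimplex ℝ Xhat) := by
  refine continuousOn_finsetSum _ fun x _ => continuousOn_const.mul
    (ContinuousOn.log (Continuous.continuousOn ?_) fun r hr => (Zf_pos d hr β x).ne')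
  unfold Zf
  fun_prop

/-- A Blahut–Arimoto step increases `avgLogZ` by at least the relative entropy of the step. -/
theorem sum_BA_mul_log_baFactor_le {p : X → ℝ} (hp : p ∈ stdSimplex ℝ X) (d : X → Xhat → ℝ)
    (β : ℝ) {r : Xhat → ℝ} (hr : r ∈ stdSimplex ℝ Xhat) :
    ∑ xh, BA p d β r xh * Real.log (baFactor p d β r xh) ≤
      avgLogZ p d β (BA p d β r) - avgLogZ p d β r := by
  have hq := isCond_enc d hr β
  have hr' := BA_mem_stdSimplex hp d β hr
  have key : ∀ x, ∑ xh, enc d r β xh x * Real.log (baFactor p d β r xh) ≤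
      Real.log (Zf d (BA p d β r) β x) - Real.log (Zf d r β x) := by
    intro x
    rw [← Real.log_div (Zf_pos d hr' β x).ne' (Zf_pos d hr β x).ne']
    refine sum_mul_log_le_log (hq x).1 (hq x).2 (fun i _ => baFactor_pos hp d β hr i) (le_of_eq ?_)
    rw [Zf, Finset.sum_div]
    refine Finset.sum_congr rfl fun xh _ => ?_
    rw [BA_eq_mul_baFactor, enc]
    ring
  calc _ = ∑ x, p x * ∑ xh, enc d r β xh x * Real.log (baFactor p d β r xh) := by
        simp only [BA, Finset.sum_mul, Finset.mul_sum]
        rw [Finset.sum_comm]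
        simp only [mul_assoc]
    _ ≤ ∑ x, p x * (Real.log (Zf d (BA p d β r) β x) - Real.log (Zf d r β x)) :=
        Finset.sum_le_sum fun x _ => mul_le_mul_of_nonneg_left (key x) (hp.1 x)
    _ = _ := by simp only [avgLogZ, mul_sub, Finset.sum_sub_distrib]

theorem BA_eq_self_of_avgLogZ_le {p : X → ℝ} (hp : p ∈ stdSimplex ℝ X) (d : X → Xhat → ℝ)
    (β : ℝ) {r : Xhat → ℝ} (hr : r ∈ stdSimplex ℝ Xhat)
    (hle : avgLogZ p d β (BA p d β r) ≤ avgLogZ p d β r) : BA p d β r = r := by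
  have hr' := BA_mem_stdSimplex hp d β hr
  have hpos : ∀ i, 0 < BA p d β r i → 0 < r i := fun i hi =>
    pos_of_mul_pos_left (BA_eq_mul_baFactor p d β r i ▸ hi) (baFactor_pos hp d β hr i).le
  have h1 := sum_sq_sqrt_sub_sqrt_le hr' hr hpos
  have h2 := sum_BA_mul_log_baFactor_le hp d β hr
  have h3 : ∑ i, BA p d β r i * Real.log (baFactor p d β r i) =
      ∑ i, BA p d β r i * Real.log (BA p d β r i) - ∑ i, BA p d β r i * Real.log (r i) := by
    rw [← Finset.sum_sub_distrib]
    refine Finset.sum_congr rfl fun i _ => ?_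
    rcases (hr'.1 i).eq_or_lt with h | h
    · simp [← h]
    · nth_rw 3 [BA_eq_mul_baFactor]
      rw [Real.log_mul (hpos i h).ne' (baFactor_pos hp d β hr i).ne']
      ring
  have h0 : ∑ i, (√(BA p d β r i) - √(r i)) ^ 2 = 0 :=
    le_antisymm (by linarith) (Finset.sum_nonneg fun i _ => sq_nonneg _)
  funext i
  have := (Finset.sum_eq_zero_iff_of_nonneg fun i _ => sq_nonneg _).1 h0 i (Finset.mem_univ i)
  rw [sq_eq_zero_iff, sub_eq_zero] at this
  exact (Real.sqrt_inj (hr'.1 i) (hr.1 i)).1 this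

/-- Relative entropy from a fixed point decreases along a Blahut–Arimoto step by at least the
gap in `avgLogZ`. -/
theorem avgLogZ_sub_le {p : X → ℝ} (hp : p ∈ stdSimplex ℝ X) (d : X → Xhat → ℝ)
    (β : ℝ) {s r : Xhat → ℝ} (hs : s ∈ stdSimplex ℝ Xhat) (hfix : BA p d β s = s)
    (hr : r ∈ stdSimplex ℝ Xhat) (hsr : ∀ i, 0 < s i → 0 < r i) :
    avgLogZ p d β s - avgLogZ p d β r ≤
      ∑ i, s i * Real.log (BA p d β r i) - ∑ i, s i * Real.log (r i) := by
  have hlog : ∀ i, s i * Real.log (BA p d β r i) - s i * Real.log (r i) =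
      s i * Real.log (baFactor p d β r i) := by
    intro i
    rcases (hs.1 i).eq_or_lt with h | h
    · simp [← h]
    · rw [BA_eq_mul_baFactor, Real.log_mul (hsr i h).ne' (baFactor_pos hp d β hr i).ne']
      ring
  rw [← Finset.sum_sub_distrib, Finset.sum_congr rfl fun i _ => hlog i]
  have key : ∀ i, s i * ∑ x, p x * (Real.exp (-β * d x i) / Zf d s β x) *
      Real.log (Zf d s β x / Zf d r β x) ≤ s i * Real.log (baFactor p d β r i) := by
    intro i
    rcases (hs.1 i).eq_or_lt with h | h
    · simp [← h]
    refine mul_le_mul_of_nonneg_left (sum_mul_log_le_log (fun x => ?_) ?_ (fun x _ => ?_)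
      (le_of_eq ?_)) h.le
    · exact mul_nonneg (hp.1 x) (div_pos (Real.exp_pos _) (Zf_pos d hs β x)).le
    · have := congrFun hfix i
      rw [BA_eq_mul_baFactor] at this
      exact mul_left_cancel₀ h.ne' (this.trans (mul_one _).symm)
    · exact div_pos (Zf_pos d hs β x) (Zf_pos d hr β x)
    · refine Finset.sum_congr rfl fun x _ => ?_
      rw [mul_assoc, div_mul_div_cancel₀ (Zf_pos d hs β x).ne']
  refine le_of_eq_of_le ?_ (Finset.sum_le_sum fun i _ => key i)
  simp only [Finset.mul_sum, avgLogZ]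
  rw [Finset.sum_comm, ← Finset.sum_sub_distrib]
  refine Finset.sum_congr rfl fun x _ => ?_
  rw [Real.log_div (Zf_pos d hs β x).ne' (Zf_pos d hr β x).ne', ← mul_sub]
  have h1 := (isCond_enc d hs β x).2
  set l := Real.log (Zf d s β x) - Real.log (Zf d r β x)
  calc p x * l = p x * (∑ i, enc d s β i x) * l := by rw [h1, mul_one]
    _ = _ := by
      rw [Finset.mul_sum, Finset.sum_mul]
      refine Finset.sum_congr rfl fun i _ => ?_
      rw [enc]
      ring

theorem Lagr_eq_sum (p : X → ℝ) (d : X → Xhat → ℝ) (β : ℝ) (q : Xhat → X → ℝ) :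
    Lagr p d β q = ∑ x, ∑ xh, ((if 0 < p x * q xh x then
      p x * q xh x * Real.log (q xh x / margQ p q xh) else 0) + p x * q xh x * (β * d x xh)) := by
  simp only [Lagr, mutualInfo, expDist, Finset.mul_sum, Finset.sum_add_distrib]
  congr 1
  exact Finset.sum_congr rfl fun x _ => Finset.sum_congr rfl fun i _ => by ring

theorem margQ_pos {p : X → ℝ} (hp : p ∈ stdSimplex ℝ X) {q : Xhat → X → ℝ} (hq : IsCond q)
    {x : X} {xh : Xhat} (h : 0 < p x * q xh x) : 0 < margQ p q xh :=
  h.trans_le (Finset.single_le_sum (f := fun x => p x * q xh x)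
    (fun y _ => mul_nonneg (hp.1 y) ((hq y).1 xh)) (Finset.mem_univ x))

theorem neg_avgLogZ_margQ_le_Lagr {p : X → ℝ} (hp : p ∈ stdSimplex ℝ X) (d : X → Xhat → ℝ)
    (β : ℝ) {q : Xhat → X → ℝ} (hq : IsCond q) :
    -avgLogZ p d β (margQ p q) ≤ Lagr p d β q := by
  have hm := margQ_mem_stdSimplex hp hq
  rw [Lagr_eq_sum, avgLogZ, ← Finset.sum_neg_distrib]
  refine Finset.sum_le_sum fun x _ => ?_
  rcases (hp.1 x).eq_or_lt with hpx | hpx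
  · simp [← hpx]
  have hJ : ∑ xh, q xh x * Real.log (margQ p q xh * Real.exp (-β * d x xh) / q xh x) ≤
      Real.log (Zf d (margQ p q) β x) := by
    refine sum_mul_log_le_log (hq x).1 (hq x).2 (fun i hi => ?_)
      (Finset.sum_le_sum fun i _ => ?_)
    · exact div_pos (mul_pos (margQ_pos hp hq (mul_pos hpx hi)) (Real.exp_pos _)) hi
    · rcases ((hq x).1 i).eq_or_lt with h | h
      · simpa [← h] using mul_nonneg (hm.1 i) (Real.exp_pos _).le
      · rw [mul_div_cancel₀ _ h.ne']
  have := mul_le_mul_of_nonneg_left hJ hpx.le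
  refine (neg_le_neg this).trans_eq ?_
  rw [Finset.mul_sum, ← Finset.sum_neg_distrib]
  refine Finset.sum_congr rfl fun i _ => ?_
  rcases ((hq x).1 i).eq_or_lt with h | h
  · simp [← h]
  have hmi := margQ_pos hp hq (mul_pos hpx h)
  rw [if_pos (mul_pos hpx h), Real.log_div (mul_pos hmi (Real.exp_pos _)).ne' h.ne',
    Real.log_mul hmi.ne' (Real.exp_pos _).ne', Real.log_exp, Real.log_div h.ne' hmi.ne']
  ring

theorem Lagr_enc_of_BA_eq_self {p : X → ℝ} (hp : p ∈ stdSimplex ℝ X) (d : X → Xhat → ℝ)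
    (β : ℝ) {r : Xhat → ℝ} (hr : r ∈ stdSimplex ℝ Xhat) (hfix : BA p d β r = r) :
    Lagr p d β (enc d r β) = -avgLogZ p d β r := by
  have hq := isCond_enc d hr β
  have hm : margQ p (enc d r β) = r := hfix
  rw [Lagr_eq_sum, avgLogZ, ← Finset.sum_neg_distrib, hm]
  refine Finset.sum_congr rfl fun x _ => ?_
  have hZ := Zf_pos d hr β x
  have key : ∀ i, ((if 0 < p x * enc d r β i x then
      p x * enc d r β i x * Real.log (enc d r β i x / r i) else 0) +
      p x * enc d r β i x * (β * d x i)) =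
      enc d r β i x * -(p x * Real.log (Zf d r β x)) := by
    intro i
    rcases (mul_nonneg (hp.1 x) ((hq x).1 i)).eq_or_lt with h | h
    · rw [← h, if_neg (lt_irrefl 0)]
      linear_combination -Real.log (Zf d r β x) * h
    · have hri : 0 < r i := hm ▸ margQ_pos hp hq h
      rw [if_pos h]
      have : enc d r β i x / r i = Real.exp (-β * d x i) / Zf d r β x := by
        rw [enc]
        field_simp
      rw [this, Real.log_div (Real.exp_pos _).ne' hZ.ne', Real.log_exp]
      ring
  rw [Finset.sum_congr rfl fun i _ => key i, ← Finset.sum_mul, (hq x).2, one_mul]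

/-- **Blahut–Arimoto converges to a distribution achieving the RD curve of the problem
reduced to the initial support** (Theorem
`thm:BA-converges-to-RD-curve-for-an-initial-cond-of-arbitrary-support`):
the iterates `BA_β^n[r₀]` converge to a probability distribution `r*` supported in
`S = supp r₀`, whose corresponding conditional distribution `q*` (with marginal `r*`,
supported in `S`) minimizes `L_β` over all conditional distributions supported in `S`. -/
theorem baConvergesOnRestrictedSupport (p : X → ℝ) (hp0 : ∀ x, 0 ≤ p x)
    (hp1 : ∑ x, p x = 1) (d : X → Xhat → ℝ) (β : ℝ) (hβ : 0 < β)
    (r₀ : Xhat → ℝ) (hr0 : ∀ xh, 0 ≤ r₀ xh) (hr1 : ∑ xh, r₀ xh = 1) :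
    ∃ rstar : Xhat → ℝ,
      Filter.Tendsto (fun n => (BA p d β)^[n] r₀) Filter.atTop (nhds rstar) ∧
      (∀ xh, 0 ≤ rstar xh) ∧ (∑ xh, rstar xh = 1) ∧
      (∀ xh, r₀ xh = 0 → rstar xh = 0) ∧
      ∃ qstar : Xhat → X → ℝ,
        IsCond qstar ∧
        (∀ (x : X) (xh : Xhat), r₀ xh = 0 → qstar xh x = 0) ∧
        (∀ xh, rstar xh = ∑ x, p x * qstar xh x) ∧
        ∀ q : Xhat → X → ℝ, IsCond q → (∀ (x : X) (xh : Xhat), r₀ xh = 0 → q xh x = 0) →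
          Lagr p d β qstar ≤ Lagr p d β q := by
  classical
  have hp : p ∈ stdSimplex ℝ X := ⟨hp0, hp1⟩
  set r : ℕ → Xhat → ℝ := fun n => (BA p d β)^[n] r₀ with hrdef
  have hsucc : ∀ n, r (n + 1) = BA p d β (r n) := fun n => Function.iterate_succ_apply' _ _ _
  have hr : ∀ n, r n ∈ stdSimplex ℝ Xhat := by
    intro n
    induction n with
    | zero => exact ⟨hr0, hr1⟩
    | succ n ih => rw [hsucc]; exact BA_mem_stdSimplex hp d β ih
  have hpos : ∀ n i, 0 < r₀ i → 0 < r n i := by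
    intro n i hi
    induction n with
    | zero => exact hi
    | succ n ih =>
      rw [hsucc, BA_eq_mul_baFactor]
      exact mul_pos ih (baFactor_pos hp d β (hr n) i)
  have hzero : ∀ n i, r₀ i = 0 → r n i = 0 := by
    intro n i hi
    induction n with
    | zero => exact hi
    | succ n ih => rw [hsucc, BA_eq_mul_baFactor, ih, zero_mul]
  set K : Set (Xhat → ℝ) := stdSimplex ℝ Xhat ∩ {s | ∀ i, r₀ i = 0 → s i = 0} with hK
  have hKc : IsCompact K := by
    refine (isCompact_stdSimplex ℝ Xhat).inter_right ?_
    simp only [Set.ofPred_forall]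
    exact isClosed_iInter fun i => isClosed_iInter fun _ =>
      isClosed_eq (continuous_apply i) continuous_const
  have hrK : ∀ n, r n ∈ K := fun n => ⟨hr n, hzero n⟩
  have hcont : ContinuousOn (avgLogZ p d β) K := (continuousOn_avgLogZ p d β).mono fun _ h => h.1
  have hfix : ∀ s ∈ K, IsMaxOn (avgLogZ p d β) K s → BA p d β s = s := by
    intro s hs hmax
    refine BA_eq_self_of_avgLogZ_le hp d β hs.1 (hmax ⟨BA_mem_stdSimplex hp d β hs.1, ?_⟩)
    intro i hi
    rw [BA_eq_mul_baFactor, hs.2 i hi, zero_mul]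
  have hac : ∀ s ∈ K, ∀ n i, 0 < s i → 0 < r n i := fun s hs n i hi =>
    hpos n i ((hr0 i).lt_of_ne fun h => hi.ne' (hs.2 i h.symm))
  -- Relative entropy from a maximizer is monotone along the iterates.
  have hstep : ∀ s ∈ K, IsMaxOn (avgLogZ p d β) K s → ∀ n,
      avgLogZ p d β s - avgLogZ p d β (r n) ≤
        ∑ i, s i * Real.log (r (n + 1) i) - ∑ i, s i * Real.log (r n i) := by
    intro s hs hmax n
    rw [hsucc]
    exact avgLogZ_sub_le hp d β hs.1 (hfix s hs hmax) (hr n) (hac s hs n)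
  have hlim : ∀ s ∈ K, IsMaxOn (avgLogZ p d β) K s →
      ∃ l, Filter.Tendsto (fun n => ∑ i, s i * Real.log (r n i)) Filter.atTop (nhds l) := by
    intro s hs hmax
    refine ⟨_, tendsto_atTop_ciSup (monotone_nat_of_le_succ fun n => ?_) ⟨0, ?_⟩⟩
    · have h1 : avgLogZ p d β (r n) ≤ avgLogZ p d β s := hmax (hrK n)
      linarith [hstep s hs hmax n]
    · rintro _ ⟨n, rfl⟩
      refine Finset.sum_nonpos fun i _ => mul_nonpos_of_nonneg_of_nonpos (hs.1.1 i)
        (Real.log_nonpos ((hr n).1 i) ?_)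
      exact (hr n).2 ▸ Finset.single_le_sum (fun j _ => (hr n).1 j) (Finset.mem_univ i)
  obtain ⟨m, hmK, hm⟩ := hKc.exists_isMaxOn ⟨r 0, hrK 0⟩ hcont
  have hval : Filter.Tendsto (fun n => avgLogZ p d β (r n)) Filter.atTop
      (nhds (avgLogZ p d β m)) := by
    obtain ⟨l, hl⟩ := hlim m hmK hm
    have h0 := (hl.comp (Filter.tendsto_add_atTop_nat 1)).sub hl
    rw [sub_self] at h0
    have h1 := squeeze_zero (fun n => sub_nonneg.2 (hm (hrK n))) (hstep m hmK hm) h0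
    simpa using h1.const_sub (avgLogZ p d β m)
  obtain ⟨s, hsK, φ, hφ, hs⟩ := hKc.tendsto_subseq hrK
  have hsval : avgLogZ p d β s = avgLogZ p d β m :=
    tendsto_nhds_unique ((hcont s hsK).tendsto.comp
      (tendsto_nhdsWithin_iff.2 ⟨hs, Filter.Eventually.of_forall fun n => hrK _⟩))
      (hval.comp hφ.tendsto_atTop)
  have hsmax : IsMaxOn (avgLogZ p d β) K s := fun t ht => by
    simpa only [Set.mem_ofPred_eq, hsval] using hm ht
  have hsfix := hfix s hsK hsmax
  have hent : Filter.Tendsto (fun n => ∑ i, s i * Real.log (r n i)) Filter.atTop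
      (nhds (∑ i, s i * Real.log (s i))) := by
    obtain ⟨l, hl⟩ := hlim s hsK hsmax
    have h1 : Filter.Tendsto (fun n => ∑ i, s i * Real.log (r (φ n) i)) Filter.atTop
        (nhds (∑ i, s i * Real.log (s i))) := by
      refine tendsto_finsetSum _ fun i _ => ?_
      rcases (hsK.1.1 i).eq_or_lt with h | h
      · simp [← h]
      · exact ((tendsto_pi_nhds.1 hs i).log h.ne').const_mul _
    exact tendsto_nhds_unique (hl.comp hφ.tendsto_atTop) h1 ▸ hl
  have hconv : Filter.Tendsto r Filter.atTop (nhds s) := by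
    refine tendsto_pi_nhds.2 fun i => ?_
    have h0 := hent.const_sub (∑ i, s i * Real.log (s i))
    rw [sub_self] at h0
    have h1 : Filter.Tendsto (fun n => (√(s i) - √(r n i)) ^ 2) Filter.atTop (nhds 0) :=
      squeeze_zero (fun n => sq_nonneg _) (fun n =>
        (Finset.single_le_sum (f := fun i => (√(s i) - √(r n i)) ^ 2)
          (fun j _ => sq_nonneg _) (Finset.mem_univ i)).trans
        (sum_sq_sqrt_sub_sqrt_le hsK.1 (hr n) (hac s hsK n))) h0
    have h2 : Filter.Tendsto (fun n => |√(s i) - √(r n i)|) Filter.atTop (nhds 0) := by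
      simpa [Real.sqrt_sq_eq_abs] using h1.sqrt
    have h3 := (((tendsto_zero_iff_abs_tendsto_zero _).2 h2).const_sub √(s i)).pow 2
    simpa [Real.sq_sqrt ((hr _).1 i), Real.sq_sqrt (hsK.1.1 i)] using h3
  refine ⟨s, hconv, hsK.1.1, hsK.1.2, hsK.2, enc d s β, isCond_enc d hsK.1 β, ?_, ?_, ?_⟩
  · intro x i hi
    simp [enc, hsK.2 i hi]
  · exact fun i => (congrFun hsfix i).symm
  · intro q hq hq0
    have hmem : margQ p q ∈ K :=
      ⟨margQ_mem_stdSimplex hp hq, fun i hi => by simp [margQ, hq0 _ i hi]⟩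
    rw [Lagr_enc_of_BA_eq_self hp d β hsK.1 hsfix]
    exact (neg_le_neg (hsmax hmem)).trans (neg_avgLogZ_margQ_le_Lagr hp d β hq)
end
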